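/- Let N > 1. Then for every α₀ ∈ (2N, 2(N+1)) there exists a unique a ∈ ℝ such that α(a) = α₀; in other words, for every α₀ ∈ (2N, 2(N+1)) there is exactly one radial solution at level α₀. -/

import Mathlib

open Real Set MeasureTheory Filter

noncomputable section

/-- `u` is a radial solution of the Liouville equation
`u'' + u'/r + (1+r²)^N e^{2u} = 0` on `(0,∞)`, of class `C²` on `[0,∞)`,
with `u'(0) = 0` and finite mass `∫₀^∞ (1+r²)^N e^{2u} r dr < ∞`. -/
def IsSol (N : ℝ) (u : ℝ → ℝ) : Prop :=
  ContDiffOn ℝ 2 u (Ici 0) ∧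
  (∀ r : ℝ, 0 < r →
    deriv (deriv u) r + deriv u r / r + (1 + r ^ 2) ^ N * Real.exp (2 * u r) = 0) ∧
  derivWithin u (Ici 0) 0 = 0 ∧
  IntegrableOn (fun r => (1 + r ^ 2) ^ N * Real.exp (2 * u r) * r) (Ioi 0)

/-- `u` is a radial solution at level `α₀`: a `C²([0,∞))` solution of
`u'' + u'/r + (1+r²)^N e^{2u} = 0` on `(0,∞)` with `u'(0) = 0` and
`∫₀^∞ (1+r²)^N e^{2u} r dr = α₀`. -/
def IsSolAtLevel (N α₀ : ℝ) (u : ℝ → ℝ) : Prop :=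
  ContDiffOn ℝ 2 u (Ici 0) ∧
  (∀ r : ℝ, 0 < r →
    deriv (deriv u) r + deriv u r / r + (1 + r ^ 2) ^ N * Real.exp (2 * u r) = 0) ∧
  derivWithin u (Ici 0) 0 = 0 ∧
  IntegrableOn (fun r => (1 + r ^ 2) ^ N * Real.exp (2 * u r) * r) (Ioi 0) ∧
  (∫ r in Ioi (0:ℝ), (1 + r ^ 2) ^ N * Real.exp (2 * u r) * r) = α₀

open scoped Topology

section Monotonicity

variable {f f' : ℝ → ℝ} {T l : ℝ}

lemma lt_of_hasDerivAt_pos_of_tendsto_atBot (hf : ∀ t, HasDerivAt f (f' t) t)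
    (hpos : ∀ t < T, 0 < f' t) (hl : Tendsto f atBot (𝓝 l)) : l < f T := by
  have hmono : StrictMonoOn f (Iic T) := by
    refine strictMonoOn_of_deriv_pos (convex_Iic T)
      (fun t _ => (hf t).continuousAt.continuousWithinAt) fun t ht => ?_
    rw [interior_Iic] at ht
    rw [(hf t).deriv]
    exact hpos t ht
  have h1 : l ≤ f (T - 1) := by
    refine le_of_tendsto hl ?_
    filter_upwards [eventually_le_atBot (T - 1)] with t ht
    exact hmono.monotoneOn (mem_Iic.2 (by linarith)) (mem_Iic.2 (by linarith)) ht
  exact h1.trans_lt (hmono (mem_Iic.2 (by linarith)) self_mem_Iic (by linarith))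

lemma le_of_hasDerivAt_nonneg_of_tendsto_atBot (hf : ∀ t, HasDerivAt f (f' t) t)
    (hpos : ∀ t < T, 0 ≤ f' t) (hl : Tendsto f atBot (𝓝 l)) : l ≤ f T := by
  have hmono : MonotoneOn f (Iic T) := by
    refine monotoneOn_of_deriv_nonneg (convex_Iic T)
      (fun t _ => (hf t).continuousAt.continuousWithinAt)
      (fun t _ => (hf t).differentiableAt.differentiableWithinAt) fun t ht => ?_
    rw [interior_Iic] at ht
    rw [(hf t).deriv]
    exact hpos t ht
  refine le_of_tendsto hl ?_
  filter_upwards [eventually_le_atBot T] with t ht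
  exact hmono (mem_Iic.2 ht) self_mem_Iic ht

lemma lt_of_hasDerivAt_pos_of_tendsto_atTop (hf : ∀ t, HasDerivAt f (f' t) t)
    (hpos : ∀ t > T, 0 < f' t) (hl : Tendsto f atTop (𝓝 l)) : f T < l := by
  have hmono : StrictMonoOn f (Ici T) := by
    refine strictMonoOn_of_deriv_pos (convex_Ici T)
      (fun t _ => (hf t).continuousAt.continuousWithinAt) fun t ht => ?_
    rw [interior_Ici] at ht
    rw [(hf t).deriv]
    exact hpos t ht
  have h1 : f (T + 1) ≤ l := by
    refine ge_of_tendsto hl ?_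
    filter_upwards [eventually_ge_atTop (T + 1)] with t ht
    exact hmono.monotoneOn (mem_Ici.2 (by linarith)) (mem_Ici.2 (by linarith)) ht
  exact (hmono self_mem_Ici (mem_Ici.2 (by linarith)) (by linarith)).trans_le h1

lemma HasDerivAt.nonpos_of_nonneg_left {d x : ℝ} (hd : HasDerivAt f d x) (hx : f x = 0)
    (hf : ∀ᶠ y in 𝓝[<] x, 0 ≤ f y) : d ≤ 0 := by
  have h : Tendsto (slope f x) (𝓝[<] x) (𝓝 d) := (hasDerivAt_iff_tendsto_slope.1 hd).mono_left
    (nhdsWithin_mono x (fun y (hy : y < x) => hy.ne))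
  refine le_of_tendsto h ?_
  filter_upwards [hf, self_mem_nhdsWithin] with y hy hyx
  rw [slope_def_field, hx]
  have : y - x < 0 := by have : y < x := hyx; linarith
  exact div_nonpos_of_nonneg_of_nonpos (by linarith) this.le

lemma HasDerivAt.eventually_neg_right {d x : ℝ} (hd : HasDerivAt f d x) (hx : f x = 0)
    (hneg : d < 0) : ∀ᶠ y in 𝓝[>] x, f y < 0 := by
  have h : Tendsto (slope f x) (𝓝[>] x) (𝓝 d) := (hasDerivAt_iff_tendsto_slope.1 hd).mono_left
    (nhdsWithin_mono x (fun y (hy : x < y) => hy.ne'))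
  filter_upwards [h.eventually (gt_mem_nhds hneg), self_mem_nhdsWithin] with y hy hyx
  have hyx' : 0 < y - x := sub_pos.2 hyx
  rw [slope_def_field, hx, div_lt_iff₀ hyx'] at hy
  linarith

end Monotonicity

/-- The function `r² / (1 + r²)` in the variable `t = log r`. -/
def rho (t : ℝ) : ℝ := Real.exp (2 * t) / (1 + Real.exp (2 * t))

lemma rho_pos (t : ℝ) : 0 < rho t := by unfold rho; positivity

lemma rho_lt_one (t : ℝ) : rho t < 1 := by
  unfold rho
  rw [div_lt_one (by positivity)]
  linarith

lemma hasDerivAt_exp_two_mul (t : ℝ) :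
    HasDerivAt (fun t => Real.exp (2 * t)) (2 * Real.exp (2 * t)) t := by
  have := ((hasDerivAt_id t).const_mul 2).exp
  simpa [mul_comm] using this

lemma hasDerivAt_rho (t : ℝ) : HasDerivAt rho (2 * rho t * (1 - rho t)) t := by
  have h := (hasDerivAt_exp_two_mul t).div ((hasDerivAt_exp_two_mul t).const_add 1)
    (by positivity)
  refine h.congr_deriv ?_
  unfold rho
  field_simp

lemma strictMono_rho : StrictMono rho :=
  strictMono_of_hasDerivAt_pos hasDerivAt_rho fun t => by
    have := rho_pos t
    have := rho_lt_one t
    have : 0 < 1 - rho t := by linarith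
    positivity

lemma tendsto_exp_two_mul_atBot : Tendsto (fun t : ℝ => Real.exp (2 * t)) atBot (𝓝 0) :=
  Real.tendsto_exp_atBot.comp (tendsto_id.const_mul_atBot (by norm_num))

lemma tendsto_rho_atBot : Tendsto rho atBot (𝓝 0) := by
  have h := tendsto_exp_two_mul_atBot.div (tendsto_exp_two_mul_atBot.const_add 1) (by norm_num)
  rw [zero_div] at h
  exact h

lemma tendsto_rho_atTop : Tendsto rho atTop (𝓝 1) := by
  have h1 : Tendsto (fun t : ℝ => 1 + Real.exp (2 * t)) atTop atTop :=
    tendsto_atTop_add_const_left _ _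
      (Real.tendsto_exp_atTop.comp (tendsto_id.const_mul_atTop (by norm_num)))
  have h2 := (tendsto_inv_atTop_zero.comp h1).const_sub 1
  rw [sub_zero] at h2
  refine h2.congr fun t => ?_
  simp only [Function.comp, rho]
  field_simp
  ring

/-- A radial solution in the variable `t = log r`: `U` is the solution, `m` its mass inside the
ball of radius `r`, and `g` the mass density with respect to `dt`. -/
structure IsTraj (N a α : ℝ) (U m g : ℝ → ℝ) : Prop where
  deriv_U : ∀ t, HasDerivAt U (-m t) t
  deriv_m : ∀ t, HasDerivAt m (g t) t
  g_eq : ∀ t, g t = Real.exp (2 * t) * (1 + Real.exp (2 * t)) ^ N * Real.exp (2 * U t)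
  U_bot : Tendsto U atBot (𝓝 a)
  m_bot : Tendsto m atBot (𝓝 0)
  m_top : Tendsto m atTop (𝓝 α)

namespace IsTraj

variable {N a α : ℝ} {U m g : ℝ → ℝ} (h : IsTraj N a α U m g)
include h
lemma g_pos (t : ℝ) : 0 < g t := by
  rw [h.g_eq]
  positivity

lemma deriv_g (t : ℝ) : HasDerivAt g (g t * (2 + 2 * N * rho t - 2 * m t)) t := by
  have hpos : 0 < 1 + Real.exp (2 * t) := by positivity
  have hg : g = fun t => Real.exp (2 * t) * (1 + Real.exp (2 * t)) ^ N * Real.exp (2 * U t) :=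
    funext h.g_eq
  have h1 := ((hasDerivAt_exp_two_mul t).const_add 1).rpow_const (p := N) (Or.inl hpos.ne')
  have h2 := ((hasDerivAt_exp_two_mul t).mul h1).mul ((h.deriv_U t).const_mul 2).exp
  rw [h.g_eq t, hg]
  refine h2.congr_deriv ?_
  simp only [Pi.mul_apply]
  rw [Real.rpow_sub_one hpos.ne']
  unfold rho
  field_simp
  ring

lemma g_bot : Tendsto g atBot (𝓝 0) := by
  have h1 : Tendsto (fun t => (1 + Real.exp (2 * t)) ^ N) atBot (𝓝 ((1 + 0) ^ N)) :=
    (tendsto_exp_two_mul_atBot.const_add 1).rpow_const (Or.inl (by norm_num))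
  have h2 := (tendsto_exp_two_mul_atBot.mul h1).mul (h.U_bot.const_mul 2).rexp
  rw [zero_mul, zero_mul] at h2
  exact h2.congr fun t => (h.g_eq t).symm

lemma m_pos (t : ℝ) : 0 < m t :=
  lt_of_hasDerivAt_pos_of_tendsto_atBot h.deriv_m (fun t _ => h.g_pos t) h.m_bot

lemma m_lt (t : ℝ) : m t < α :=
  lt_of_hasDerivAt_pos_of_tendsto_atTop h.deriv_m (fun t _ => h.g_pos t) h.m_top

lemma strictMono_m : StrictMono m :=
  strictMono_of_hasDerivAt_pos h.deriv_m h.g_pos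

lemma level_pos : 0 < α := (h.m_pos 0).trans (h.m_lt 0)

lemma U_antitone : Antitone U :=
  antitone_of_hasDerivAt_nonpos h.deriv_U fun t => by
    have := h.m_pos t
    simp only [Pi.zero_apply]
    linarith

lemma U_le (t : ℝ) : U t ≤ a := by
  refine ge_of_tendsto h.U_bot ?_
  filter_upwards [eventually_le_atBot t] with s hs using h.U_antitone hs

lemma deriv_excess (t : ℝ) :
    HasDerivAt (fun t => g t - m t * (2 - m t)) (2 * N * rho t * g t) t := by
  refine ((h.deriv_g t).sub ((h.deriv_m t).mul ((h.deriv_m t).const_sub 2))).congr_deriv ?_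
  ring

lemma excess_bot : Tendsto (fun t => g t - m t * (2 - m t)) atBot (𝓝 0) := by
  simpa using h.g_bot.sub (h.m_bot.mul (h.m_bot.const_sub 2))

lemma excess_pos (hN : 0 < N) (t : ℝ) : 0 < g t - m t * (2 - m t) :=
  (lt_of_hasDerivAt_pos_of_tendsto_atBot (T := t) h.deriv_excess (fun t _ => by
    have := h.g_pos t
    have := rho_pos t
    positivity) h.excess_bot :)

lemma deriv_excess_sub (c t : ℝ) :
    HasDerivAt (fun t => (g t - m t * (2 - m t)) - 2 * N * c * m t)
      (2 * N * (rho t - c) * g t) t := by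
  refine ((h.deriv_excess t).sub ((h.deriv_m t).const_mul (2 * N * c))).congr_deriv ?_
  ring

lemma g_top (hN : 0 < N) : Tendsto g atTop (𝓝 0) := by
  have hmono : Monotone fun t => g t - m t * (2 - m t) :=
    monotone_of_hasDerivAt_nonneg h.deriv_excess fun t => by
      have := h.g_pos t
      have := rho_pos t
      simp only [Pi.zero_apply]
      positivity
  have hbdd : ∀ t, g t - m t * (2 - m t) ≤ 2 * N * α := by
    intro t
    have hanti : Antitone fun t => (g t - m t * (2 - m t)) - 2 * N * 1 * m t :=
      antitone_of_hasDerivAt_nonpos (h.deriv_excess_sub 1) fun t => by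
        have h1 := h.g_pos t
        have h2 := rho_lt_one t
        have : 0 ≤ 2 * N * (1 - rho t) * g t := by
          have : 0 < 1 - rho t := by linarith
          positivity
        simp only [Pi.zero_apply]
        linarith
    have hlim : Tendsto (fun t => (g t - m t * (2 - m t)) - 2 * N * 1 * m t) atBot (𝓝 0) := by
      simpa using h.excess_bot.sub (h.m_bot.const_mul (2 * N * 1))
    have h1 : (g t - m t * (2 - m t)) - 2 * N * 1 * m t ≤ 0 :=
      ge_of_tendsto hlim (by filter_upwards [eventually_le_atBot t] with s hs using hanti hs)
    nlinarith [h.m_lt t]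
  obtain ⟨L, hL⟩ : ∃ L, Tendsto (fun t => g t - m t * (2 - m t)) atTop (𝓝 L) :=
    ⟨_, tendsto_atTop_ciSup hmono ⟨2 * N * α, by rintro _ ⟨t, rfl⟩; exact hbdd t⟩⟩
  have hg : Tendsto g atTop (𝓝 (L + α * (2 - α))) :=
    (hL.add (h.m_top.mul (h.m_top.const_sub 2))).congr fun t => by ring
  have h0 : 0 ≤ L + α * (2 - α) := ge_of_tendsto' hg fun t => (h.g_pos t).le
  rcases h0.eq_or_lt with h0 | h0
  · rwa [← h0] at hg
  exfalso
  set c := (L + α * (2 - α)) / 2 with hc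
  have hcpos : 0 < c := by positivity
  obtain ⟨T, hT⟩ := eventually_atTop.1 (hg.eventually (lt_mem_nhds (show c < _ by linarith)))
  have hgrow : ∀ t ≥ T, c * (t - T) ≤ m t - m T := fun t ht =>
    (convex_Ici T).mul_sub_le_image_sub_of_le_deriv
      (fun s _ => (h.deriv_m s).continuousAt.continuousWithinAt)
      (fun s _ => (h.deriv_m s).differentiableAt.differentiableWithinAt)
      (fun s hs => by
        rw [interior_Ici] at hs
        rw [(h.deriv_m s).deriv]
        exact (hT s (le_of_lt hs)).le) T self_mem_Ici t ht ht
  have h1 := hgrow (T + α / c) (by have := h.level_pos; have : 0 < α / c := by positivity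
                                   linarith)
  have h2 : c * (T + α / c - T) = α := by field_simp; ring
  have := h.m_lt (T + α / c)
  have := h.m_pos T
  linarith

lemma excess_top (hN : 0 < N) :
    Tendsto (fun t => g t - m t * (2 - m t)) atTop (𝓝 (α * (α - 2))) := by
  have := (h.g_top hN).sub (h.m_top.mul (h.m_top.const_sub 2))
  convert this using 2
  ring

lemma two_lt_level (hN : 0 < N) : 2 < α := by
  have h1 := (h.excess_pos hN 0).trans
    (lt_of_hasDerivAt_pos_of_tendsto_atTop (T := 0) h.deriv_excess (fun t _ => by
      have := h.g_pos t
      have := rho_pos t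
      positivity) (h.excess_top hN) :)
  have := pos_of_mul_pos_right h1 h.level_pos.le
  linarith

lemma excess_sub_top (hN : 0 < N) (c : ℝ) :
    Tendsto (fun t => (g t - m t * (2 - m t)) - 2 * N * c * m t) atTop
      (𝓝 (α * (α - 2) - 2 * N * c * α)) :=
  (h.excess_top hN).sub (h.m_top.const_mul _)

lemma excess_sub_bot (c : ℝ) :
    Tendsto (fun t => (g t - m t * (2 - m t)) - 2 * N * c * m t) atBot (𝓝 0) := by
  simpa using h.excess_bot.sub (h.m_bot.const_mul (2 * N * c))

lemma excess_le (hN : 0 < N) (T : ℝ) : g T - m T * (2 - m T) ≤ 2 * N * rho T * m T := by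
  have h1 := le_of_hasDerivAt_nonneg_of_tendsto_atBot (T := T)
    (fun t => (h.deriv_excess_sub (rho T) t).neg) (fun t ht => by
      have := h.g_pos t
      have : 0 < rho T - rho t := sub_pos.2 (strictMono_rho ht)
      have : 0 < 2 * N * (rho T - rho t) * g t := by positivity
      linarith) (h.excess_sub_bot (rho T)).neg
  simp only [Pi.neg_apply] at h1
  linarith

/-- The mass beyond `T` carries weight between `rho T` and `1` in the Pohozaev identity. -/
lemma pohozaev_upper (hN : 0 < N) (T : ℝ) :
    α * (α - 2) - 2 * N * α < g T - m T * (2 - m T) - 2 * N * m T := by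
  have h1 := lt_of_hasDerivAt_pos_of_tendsto_atTop (T := T)
    (fun t => (h.deriv_excess_sub 1 t).neg) (fun t _ => by
      have := h.g_pos t
      have : 0 < 1 - rho t := sub_pos.2 (rho_lt_one t)
      have : 0 < 2 * N * (1 - rho t) * g t := by positivity
      linarith) (h.excess_sub_top hN 1).neg
  simp only [Pi.neg_apply] at h1
  linarith

lemma pohozaev_lower (hN : 0 < N) (T : ℝ) :
    g T - m T * (2 - m T) - 2 * N * rho T * m T < α * (α - 2) - 2 * N * rho T * α :=
  (lt_of_hasDerivAt_pos_of_tendsto_atTop (T := T) (h.deriv_excess_sub (rho T)) (fun t ht => by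
    have := h.g_pos t
    have : 0 < rho t - rho T := sub_pos.2 (strictMono_rho ht)
    positivity) (h.excess_sub_top hN (rho T)) :)

lemma level_lt (hN : 0 < N) : α < 2 * N + 2 := by
  have h1 := h.pohozaev_upper hN
  have h2 : α * (α - 2) - 2 * N * α ≤ 0 :=
    ge_of_tendsto (h.excess_sub_bot 1) (Eventually.of_forall fun t => by
      have := h1 t
      linarith)
  have h3 : α * (α - 2) - 2 * N * α < 0 := by
    have h4 := lt_of_hasDerivAt_pos_of_tendsto_atBot (T := 0)
      (fun t => (h.deriv_excess_sub 1 t).neg) (fun t _ => by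
        have := h.g_pos t
        have : 0 < 1 - rho t := sub_pos.2 (rho_lt_one t)
        have : 0 < 2 * N * (1 - rho t) * g t := by positivity
        linarith) (h.excess_sub_bot 1).neg
    have := h1 0
    simp only [Pi.neg_apply] at h4
    linarith
  by_contra! hcon
  nlinarith [h.level_pos]

lemma deriv_outer (c t : ℝ) :
    HasDerivAt (fun t => (c - m t) * (c + m t - 2 * N - 2))
      (g t * (2 * N + 2 - 2 * m t)) t := by
  have h1 := ((h.deriv_m t).const_sub c).mul
    ((((h.deriv_m t).const_add c).sub_const (2 * N)).sub_const 2)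
  refine h1.congr_deriv ?_
  ring

lemma outer_top : Tendsto (fun t => (α - m t) * (α + m t - 2 * N - 2)) atTop (𝓝 0) := by
  have h1 := (h.m_top.const_sub α).mul
    (((h.m_top.const_add α).sub_const (2 * N)).sub_const 2)
  simpa using h1

lemma outer_lt (hN : 0 < N) (t : ℝ) : (α - m t) * (α + m t - 2 * N - 2) < g t := by
  have h1 := lt_of_hasDerivAt_pos_of_tendsto_atTop (T := t)
    (fun t => (h.deriv_outer α t).sub (h.deriv_g t)) (fun t _ => by
      have := h.g_pos t
      have : 0 < 1 - rho t := sub_pos.2 (rho_lt_one t)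
      have : 0 < 2 * N * (1 - rho t) * g t := by positivity
      linarith) (h.outer_top.sub (h.g_top hN))
  simp only [Pi.sub_apply] at h1
  linarith

/-- Upper bound on the mass when the central value is very negative. -/
lemma m_le_exp (hN : 0 < N) (T : ℝ) :
    m T ≤ Real.exp (2 * T) * (1 + Real.exp (2 * T)) ^ N * Real.exp (2 * a) / 2 := by
  set c := (1 + Real.exp (2 * T)) ^ N * Real.exp (2 * a) with hc
  have h1 := le_of_hasDerivAt_nonneg_of_tendsto_atBot (T := T) (l := 0)
    (fun t => (((hasDerivAt_exp_two_mul t).mul_const (c / 2)).sub (h.deriv_m t)))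
    (fun t ht => by
      rw [h.g_eq t]
      have h2 : (1 + Real.exp (2 * t)) ^ N ≤ (1 + Real.exp (2 * T)) ^ N := by gcongr
      have h3 : Real.exp (2 * U t) ≤ Real.exp (2 * a) := by gcongr; exact h.U_le t
      have h4 : (1 + Real.exp (2 * t)) ^ N * Real.exp (2 * U t) ≤ c := by rw [hc]; gcongr
      nlinarith [Real.exp_pos (2 * t)])
    (by simpa [Pi.sub_def] using (tendsto_exp_two_mul_atBot.mul_const (c / 2)).sub h.m_bot)
  simp only [Pi.sub_apply] at h1
  rw [hc] at h1
  linarith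

lemma exp_le_m (hN : 0 < N) (T : ℝ) :
    Real.exp (2 * T) * Real.exp (2 * U T) / 2 ≤ m T := by
  set c := Real.exp (2 * U T) with hc
  have h1 := le_of_hasDerivAt_nonneg_of_tendsto_atBot (T := T) (l := 0)
    (fun t => ((h.deriv_m t).sub ((hasDerivAt_exp_two_mul t).mul_const (c / 2))))
    (fun t ht => by
      rw [h.g_eq t]
      have h2 : 1 ≤ (1 + Real.exp (2 * t)) ^ N :=
        Real.one_le_rpow (by linarith [Real.exp_pos (2 * t)]) hN.le
      have h3 : c ≤ Real.exp (2 * U t) := by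
        rw [hc]; gcongr; exact h.U_antitone ht.le
      have h4 : Real.exp (2 * t) * c ≤
          Real.exp (2 * t) * (1 + Real.exp (2 * t)) ^ N * Real.exp (2 * U t) := by
        rw [mul_assoc]
        gcongr
        nlinarith [Real.exp_pos (2 * U t)]
      linarith)
    (by simpa [Pi.sub_def] using h.m_bot.sub (tendsto_exp_two_mul_atBot.mul_const (c / 2)))
  simp only [Pi.sub_apply] at h1
  linarith

/-- Lower bound on the mass when the central value is very large. -/
lemma two_sub_m_le (hN : 0 < N) (T : ℝ) : 2 - m T ≤ 2 * Real.exp (U T - a) := by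
  have h1 := le_of_hasDerivAt_nonneg_of_tendsto_atBot (T := T) (l := -(2 * Real.exp (-a)))
    (fun t => (((h.deriv_m t).const_sub 2).mul (h.deriv_U t).neg.exp).neg)
    (fun t _ => by
      have h2 := h.excess_pos hN t
      have h3 := Real.exp_pos (-U t)
      have h4 := mul_pos h2 h3
      simp only [Pi.neg_apply]
      linarith)
    (by simpa [Pi.neg_def, Pi.mul_def] using ((h.m_bot.const_sub 2).mul h.U_bot.neg.rexp).neg)
  simp only [Pi.neg_apply, Pi.mul_apply] at h1
  have h5 : (2 - m T) * Real.exp (-U T) * Real.exp (U T) ≤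
      2 * Real.exp (-a) * Real.exp (U T) := by
    refine mul_le_mul_of_nonneg_right ?_ (Real.exp_pos _).le
    linarith
  rw [mul_assoc, mul_assoc, ← Real.exp_add, ← Real.exp_add, neg_add_cancel, Real.exp_zero,
    mul_one] at h5
  rwa [show U T - a = -a + U T by ring]

lemma level_gap_le (hN : 0 < N) (T : ℝ) :
    2 * N + 2 - α ≤ N * (Real.exp (2 * T) * (1 + Real.exp (2 * T)) ^ N * Real.exp (2 * a))
      + N * (2 * N + 2) * (1 - rho T) := by
  have h1 := h.pohozaev_lower hN T
  have h2 := h.excess_pos hN T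
  have h3 := h.m_le_exp hN T
  have h4 := h.two_lt_level hN
  have h5 := h.level_lt hN
  have h6 := rho_pos T
  have h7 := rho_lt_one T
  have h8 := h.m_pos T
  set E := Real.exp (2 * T) * (1 + Real.exp (2 * T)) ^ N * Real.exp (2 * a)
  have h9 : α * (2 * N + 2 - α) ≤ N * E + 2 * N * ((1 - rho T) * (2 * N + 2)) := by
    have e1 : 2 * N * rho T * m T ≤ 2 * N * m T := by
      have : 0 < N * m T := by positivity
      nlinarith
    have e2 : 2 * N * m T ≤ N * E := by nlinarith
    have e3 : (1 - rho T) * α ≤ (1 - rho T) * (2 * N + 2) :=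
      mul_le_mul_of_nonneg_left h5.le (by linarith)
    nlinarith
  have hE : 0 ≤ E := by linarith
  nlinarith [mul_nonneg hN.le hE]

lemma level_prod_le (hN : 0 < N) (T : ℝ) :
    (α - 2) * (α - 2 * N) ≤ 2 * N * (2 * N + 2) * rho T
      + 4 * N * ((1 + (4 * N + 4) * Real.exp (-(2 * T))) * Real.exp (-a)) := by
  have h1 := h.pohozaev_upper hN T
  have h2 := h.excess_le hN T
  have h3 := h.two_sub_m_le hN T
  have h4 := h.exp_le_m hN T
  have h5 := (h.m_lt T).trans (h.level_lt hN)
  have h6 := rho_pos T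
  have h7 : Real.exp (U T) ≤ 1 + (4 * N + 4) * Real.exp (-(2 * T)) := by
    have e1 : Real.exp (U T) ≤ 1 + Real.exp (2 * U T) := by
      rw [two_mul, Real.exp_add]
      nlinarith [sq_nonneg (Real.exp (U T) - 1), Real.exp_pos (U T)]
    have e2 : Real.exp (2 * U T) ≤ (4 * N + 4) * Real.exp (-(2 * T)) := by
      have e3 : Real.exp (2 * T) * Real.exp (2 * U T) ≤ 4 * N + 4 := by linarith
      rw [Real.exp_neg, ← div_eq_mul_inv, le_div_iff₀ (Real.exp_pos _)]
      linarith
    linarith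
  have h8 : Real.exp (U T - a) ≤ (1 + (4 * N + 4) * Real.exp (-(2 * T))) * Real.exp (-a) := by
    rw [sub_eq_add_neg, Real.exp_add]
    gcongr
  have h9 : 2 * N * rho T * m T ≤ 2 * N * rho T * (2 * N + 2) := by gcongr
  have h10 : 2 * N * (2 - m T) ≤
      2 * N * (2 * ((1 + (4 * N + 4) * Real.exp (-(2 * T))) * Real.exp (-a))) := by
    gcongr
    linarith
  linarith

end IsTraj

lemma IsTraj.tendsto_prod_ratio_atBot {N a b α β : ℝ} {U₁ m₁ g₁ U₂ m₂ g₂ : ℝ → ℝ}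
    (h₁ : IsTraj N a α U₁ m₁ g₁) (h₂ : IsTraj N b β U₂ m₂ g₂)
    (hlt : ∀ᶠ t in atBot, g₁ t < g₂ t) :
    Tendsto (fun t => m₁ t * (2 - m₁ t) - m₂ t * (2 - m₂ t) * (g₁ t / g₂ t)) atBot (𝓝 0) := by
  have q₁ := h₁.m_bot.mul (h₁.m_bot.const_sub 2)
  have q₂ := h₂.m_bot.mul (h₂.m_bot.const_sub 2)
  rw [zero_mul] at q₁ q₂
  have h3 : Tendsto (fun t => m₂ t * (2 - m₂ t) * (g₁ t / g₂ t)) atBot (𝓝 0) := by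
    refine squeeze_zero_norm' (a := fun t => ‖m₂ t * (2 - m₂ t)‖) ?_ (by simpa using q₂.norm)
    filter_upwards [hlt] with t ht
    rw [norm_mul]
    refine mul_le_of_le_one_right (norm_nonneg _) ?_
    have e1 := h₁.g_pos t
    have e2 := h₂.g_pos t
    rw [Real.norm_of_nonneg (by positivity), div_le_one e2]
    exact ht.le
  simpa using q₁.sub h3

lemma IsTraj.deriv_prod_ratio {N a b α β c : ℝ} {U₁ m₁ g₁ U₂ m₂ g₂ Q₁ Q₂ : ℝ → ℝ} {t : ℝ}
    (h₁ : IsTraj N a α U₁ m₁ g₁) (h₂ : IsTraj N b β U₂ m₂ g₂)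
    (hQ₁ : HasDerivAt Q₁ (g₁ t * (c - 2 * m₁ t)) t)
    (hQ₂ : HasDerivAt Q₂ (g₂ t * (c - 2 * m₂ t)) t) :
    HasDerivAt (fun t => Q₁ t - Q₂ t * (g₁ t / g₂ t))
      (2 * (m₂ t - m₁ t) * (g₁ t / g₂ t) * (g₂ t - Q₂ t)) t := by
  have e2 := (h₂.g_pos t).ne'
  refine (hQ₁.sub (hQ₂.mul ((h₁.deriv_g t).div (h₂.deriv_g t) e2))).congr_deriv ?_
  simp only [Pi.div_apply]
  field_simp
  ring

/-- Two trajectories with the same total mass `α > 2N` cannot start in strict order. -/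
lemma IsTraj.not_eventually_lt {N a b α : ℝ} {U₁ m₁ g₁ U₂ m₂ g₂ : ℝ → ℝ} (hN : 0 < N)
    (hα : 2 * N < α) (h₁ : IsTraj N a α U₁ m₁ g₁) (h₂ : IsTraj N b α U₂ m₂ g₂) :
    ¬ ∀ᶠ t in atBot, g₁ t < g₂ t := by
  intro hlt
  have dM : ∀ t, HasDerivAt (fun t => m₂ t - m₁ t) (g₂ t - g₁ t) t := fun t =>
    (h₂.deriv_m t).sub (h₁.deriv_m t)
  have cM : Continuous fun t => m₂ t - m₁ t :=
    continuous_iff_continuousAt.2 fun t => (dM t).continuousAt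
  have M_bot : Tendsto (fun t => m₂ t - m₁ t) atBot (𝓝 0) := by
    simpa using h₂.m_bot.sub h₁.m_bot
  have M_top : Tendsto (fun t => m₂ t - m₁ t) atTop (𝓝 0) := by
    simpa using h₂.m_top.sub h₁.m_top
  obtain ⟨T, hT⟩ := eventually_atBot.1 hlt
  have hMT : ∀ t ≤ T, 0 < m₂ t - m₁ t := fun t ht =>
    (lt_of_hasDerivAt_pos_of_tendsto_atBot (T := t) dM
      (fun s hs => sub_pos.2 (hT s (hs.le.trans ht))) M_bot :)
  -- the two mass functions meet
  obtain ⟨s, hs⟩ : ∃ s, m₂ s - m₁ s ≤ 0 := by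
    by_contra! hpos
    have dJ : ∀ t, HasDerivAt (fun t => (g₁ t - m₁ t * (2 - m₁ t)) - (g₂ t - m₂ t * (2 - m₂ t))
        + 2 * N * (rho t * (m₂ t - m₁ t)))
        (2 * N * ((2 * rho t * (1 - rho t)) * (m₂ t - m₁ t))) t := fun t => by
      refine (((h₁.deriv_excess t).sub (h₂.deriv_excess t)).add
        (((hasDerivAt_rho t).mul (dM t)).const_mul (2 * N))).congr_deriv ?_
      ring
    have hJ : ∀ t, 0 < 2 * N * ((2 * rho t * (1 - rho t)) * (m₂ t - m₁ t)) := fun t => by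
      have := rho_pos t
      have : 0 < 1 - rho t := sub_pos.2 (rho_lt_one t)
      have := hpos t
      positivity
    have e1 := lt_of_hasDerivAt_pos_of_tendsto_atBot (T := 0) (l := 0) dJ (fun t _ => hJ t) (by
      simpa using (h₁.excess_bot.sub h₂.excess_bot).add
        ((tendsto_rho_atBot.mul M_bot).const_mul (2 * N)))
    have e2 := lt_of_hasDerivAt_pos_of_tendsto_atTop (T := 0) (l := 0) dJ (fun t _ => hJ t) (by
      simpa using ((h₁.excess_top hN).sub (h₂.excess_top hN)).add
        ((tendsto_rho_atTop.mul M_top).const_mul (2 * N)))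
    linarith
  -- the first meeting point
  obtain ⟨t₀, ht₀, hbefore⟩ : ∃ t₀, m₂ t₀ - m₁ t₀ = 0 ∧ ∀ t < t₀, 0 < m₂ t - m₁ t := by
    have hclosed : IsClosed {t | m₂ t - m₁ t ≤ 0} := isClosed_le cM continuous_const
    have hbdd : BddBelow {t | m₂ t - m₁ t ≤ 0} :=
      ⟨T, fun t (ht : _ ≤ _) => le_of_not_ge fun h => (hMT t h).not_ge ht⟩
    have hmem := hclosed.csInf_mem ⟨s, hs⟩ hbdd
    have hb : ∀ t < sInf {t | m₂ t - m₁ t ≤ 0}, 0 < m₂ t - m₁ t := fun t ht =>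
      not_le.1 fun h => ht.not_ge (csInf_le hbdd h)
    refine ⟨_, le_antisymm hmem ?_, hb⟩
    refine ge_of_tendsto ((cM.tendsto _).mono_left (nhdsWithin_le_nhds (s := Iio (sInf {t | m₂ t - m₁ t ≤ 0})))) ?_
    filter_upwards [self_mem_nhdsWithin] with t ht using (hb t ht).le
  have hm₀ : m₁ t₀ = m₂ t₀ := by linarith
  have p₁ := h₁.g_pos t₀
  have p₂ := h₂.g_pos t₀
  have hle : g₂ t₀ - g₁ t₀ ≤ 0 := (dM t₀).nonpos_of_nonneg_left ht₀
    (by filter_upwards [self_mem_nhdsWithin] with t ht using (hbefore t ht).le)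
  have hinner : 0 < m₁ t₀ * (2 - m₁ t₀) - m₂ t₀ * (2 - m₂ t₀) * (g₁ t₀ / g₂ t₀) := by
    have dV : ∀ t, HasDerivAt
        (fun t => m₁ t * (2 - m₁ t) - m₂ t * (2 - m₂ t) * (g₁ t / g₂ t))
        (2 * (m₂ t - m₁ t) * (g₁ t / g₂ t) * (g₂ t - m₂ t * (2 - m₂ t))) t := fun t =>
      h₁.deriv_prod_ratio (c := 2) h₂
        (((h₁.deriv_m t).mul ((h₁.deriv_m t).const_sub 2)).congr_deriv (by ring))
        (((h₂.deriv_m t).mul ((h₂.deriv_m t).const_sub 2)).congr_deriv (by ring))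
    exact (lt_of_hasDerivAt_pos_of_tendsto_atBot (T := t₀) dV (fun t ht => by
      have := hbefore t ht
      have := h₂.excess_pos hN t
      have := h₁.g_pos t
      have := h₂.g_pos t
      positivity) (h₁.tendsto_prod_ratio_atBot h₂ hlt) :)
  have hratio : 1 ≤ g₁ t₀ / g₂ t₀ := by
    rw [one_le_div p₂]
    linarith
  rw [hm₀] at hinner
  have hq : 0 < (m₂ t₀ * (m₂ t₀ - 2)) * (g₁ t₀ / g₂ t₀ - 1) := by linarith
  have hq2 := pos_of_mul_pos_left hq (by linarith)
  have hratio' := pos_of_mul_pos_right hq hq2.le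
  have hm2 : 2 < m₂ t₀ := by
    have := pos_of_mul_pos_right hq2 (h₂.m_pos t₀).le
    linarith
  have hglt : g₂ t₀ - g₁ t₀ < 0 := by
    rw [sub_pos, one_lt_div p₂] at hratio'
    linarith
  -- the outer comparison function and its sign from the meeting point on
  have dW : ∀ t, HasDerivAt (fun t => (α - m₁ t) * (α + m₁ t - 2 * N - 2)
      - (α - m₂ t) * (α + m₂ t - 2 * N - 2) * (g₁ t / g₂ t))
      (2 * (m₂ t - m₁ t) * (g₁ t / g₂ t) * (g₂ t - (α - m₂ t) * (α + m₂ t - 2 * N - 2))) t :=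
    fun t => h₁.deriv_prod_ratio h₂ (h₁.deriv_outer α t) (h₂.deriv_outer α t)
  set W : ℝ → ℝ := fun t => (α - m₁ t) * (α + m₁ t - 2 * N - 2)
      - (α - m₂ t) * (α + m₂ t - 2 * N - 2) * (g₁ t / g₂ t) with hW
  have hQ : ∀ t ≥ t₀, 0 < (α - m₂ t) * (α + m₂ t - 2 * N - 2) := fun t ht => by
    have := h₂.m_lt t
    have := h₂.strictMono_m.monotone ht
    apply mul_pos <;> linarith
  have hW₀ : W t₀ < 0 := by
    have := mul_pos (hQ t₀ le_rfl) hratio'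
    simp only [hW, hm₀]
    linarith
  have hanti : ∀ x, (∀ t ∈ Ioo t₀ x, m₂ t - m₁ t < 0) → ∀ t ∈ Icc t₀ x, W t ≤ W t₀ := by
    intro x hx t ht
    refine antitoneOn_of_deriv_nonpos (convex_Icc t₀ x)
      (fun s _ => (dW s).continuousAt.continuousWithinAt)
      (fun s _ => (dW s).differentiableAt.differentiableWithinAt) (fun s hs => ?_)
      (left_mem_Icc.2 (ht.1.trans ht.2)) ht ht.1
    rw [interior_Icc] at hs
    rw [(dW s).deriv]
    have e1 := hx s hs
    have e2 := sub_pos.2 (h₂.outer_lt hN s)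
    have e3 := div_pos (h₁.g_pos s) (h₂.g_pos s)
    have e4 := mul_pos (mul_pos (neg_pos.2 e1) e3) e2
    linarith
  -- no further meeting point
  have hafter : ∀ t > t₀, m₂ t - m₁ t < 0 := by
    by_contra! hex
    obtain ⟨s, hs, hs'⟩ := hex
    obtain ⟨δ, hδ, hδ'⟩ := (mem_nhdsGT_iff_exists_Ioo_subset.1
      ((dM t₀).eventually_neg_right ht₀ hglt))
    have hδ'' : ∀ t ∈ Ioo t₀ δ, m₂ t - m₁ t < 0 := fun t ht => hδ' ht
    set Z := {t | 0 ≤ m₂ t - m₁ t} ∩ Ici δ with hZ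
    have hclosed : IsClosed Z := (isClosed_le continuous_const cM).inter isClosed_Ici
    have hbdd : BddBelow Z := ⟨δ, fun t ht => ht.2⟩
    have hmem := hclosed.csInf_mem
      ⟨s, hs', le_of_not_gt fun h => (hδ'' s ⟨hs, h⟩).not_ge hs'⟩ hbdd
    set t₂ := sInf Z
    have ht₂ : t₀ < t₂ := lt_of_lt_of_le hδ hmem.2
    have hneg : ∀ t ∈ Ioo t₀ t₂, m₂ t - m₁ t < 0 := fun t ht => by
      by_contra! hc
      rcases lt_or_ge t δ with h | h
      · exact (hδ'' t ⟨ht.1, h⟩).not_ge hc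
      · exact ht.2.not_ge (csInf_le hbdd ⟨hc, h⟩)
    have hev : ∀ᶠ t in 𝓝[<] t₂, 0 ≤ -(m₂ t - m₁ t) := by
      filter_upwards [Ioo_mem_nhdsLT ht₂] with t ht
      linarith [hneg t ht]
    have hz : m₂ t₂ - m₁ t₂ = 0 := by
      refine le_antisymm ?_ hmem.1
      have := ge_of_tendsto ((cM.neg.continuousAt (x := t₂)).mono_left
        (nhdsWithin_le_nhds (s := Iio _))) hev
      simp only [Pi.neg_apply] at this
      linarith
    have hd := (dM t₂).neg.nonpos_of_nonneg_left (by simp [hz]) hev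
    have hWle := hanti t₂ hneg t₂ (right_mem_Icc.2 ht₂.le)
    have hm₂ : m₁ t₂ = m₂ t₂ := by linarith
    have hr : g₁ t₂ / g₂ t₂ ≤ 1 := by
      rw [div_le_one (h₂.g_pos t₂)]
      linarith
    have := mul_nonneg (hQ t₂ ht₂.le).le (sub_nonneg.2 hr)
    have hWnn : 0 ≤ W t₂ := by
      simp only [hW, hm₂]
      linarith
    linarith
  have hWtop : Tendsto W atTop (𝓝 0) := by
    have e1 : Tendsto (fun t => (α - m₂ t) * (α + m₂ t - 2 * N - 2) * (g₁ t / g₂ t))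
        atTop (𝓝 0) := by
      refine squeeze_zero' ?_ ?_ (h₁.g_top hN)
      · filter_upwards [eventually_ge_atTop t₀] with t ht
        exact mul_nonneg (hQ t ht).le (div_pos (h₁.g_pos t) (h₂.g_pos t)).le
      · refine Eventually.of_forall fun t => ?_
        have e2 := h₂.g_pos t
        rw [← mul_div_assoc, div_le_iff₀ e2, mul_comm]
        exact mul_le_mul_of_nonneg_left (h₂.outer_lt hN t).le (h₁.g_pos t).le
    simpa using h₁.outer_top.sub e1
  have : 0 ≤ W t₀ := le_of_tendsto hWtop (by
    filter_upwards [eventually_ge_atTop t₀] with t ht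
    exact hanti t (fun s hs => hafter s hs.1) t (right_mem_Icc.2 ht))
  linarith

section Solution

variable {N : ℝ} {u v : ℝ → ℝ}

lemma IsSol.hasDerivAt (h : IsSol N u) {r : ℝ} (hr : 0 < r) : HasDerivAt u (deriv u r) r :=
  ((h.1.contDiffAt (Ici_mem_nhds hr)).differentiableAt (by norm_num)).hasDerivAt

lemma IsSol.hasDerivAt_deriv (h : IsSol N u) {r : ℝ} (hr : 0 < r) :
    HasDerivAt (deriv u) (-(deriv u r / r) - (1 + r ^ 2) ^ N * Real.exp (2 * u r)) r := by
  have h1 : ContDiffOn ℝ 1 (deriv u) (Ioi 0) :=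
    (h.1.mono Ioi_subset_Ici_self).deriv_of_isOpen isOpen_Ioi (by norm_num)
  have h2 := ((h1.contDiffAt (Ioi_mem_nhds hr)).differentiableAt (by norm_num)).hasDerivAt
  refine h2.congr_deriv ?_
  linarith [h.2.1 r hr]

lemma IsSol.derivWithin_eq {r : ℝ} (hr : 0 < r) : derivWithin u (Ici 0) r = deriv u r :=
  derivWithin_of_mem_nhds (Ici_mem_nhds hr)

lemma IsSol.continuousOn_derivWithin (h : IsSol N u) :
    ContinuousOn (derivWithin u (Ici 0)) (Ici 0) :=
  h.1.continuousOn_derivWithin (uniqueDiffOn_Ici 0) (by norm_num)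

/-- The mass in the ball of radius `r`, extended continuously to `r = 0`. -/
lemma IsSol.hasDerivAt_mass (h : IsSol N u) {r : ℝ} (hr : 0 < r) :
    HasDerivAt (fun r => -(r * derivWithin u (Ici 0) r))
      ((1 + r ^ 2) ^ N * Real.exp (2 * u r) * r) r := by
  have h1 : HasDerivAt (fun r => -(r * deriv u r))
      ((1 + r ^ 2) ^ N * Real.exp (2 * u r) * r) r := by
    refine ((hasDerivAt_id r).mul (h.hasDerivAt_deriv hr)).neg.congr_deriv ?_
    simp only [id]
    field_simp
    ring
  refine h1.congr_of_eventuallyEq ?_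
  filter_upwards [Ioi_mem_nhds hr] with s hs
  rw [IsSol.derivWithin_eq hs]

lemma IsSol.isTraj (h : IsSol N u) :
    IsTraj N (u 0) (∫ r in Ioi (0:ℝ), (1 + r ^ 2) ^ N * Real.exp (2 * u r) * r)
      (fun t => u (Real.exp t)) (fun t => -(Real.exp t * derivWithin u (Ici 0) (Real.exp t)))
      (fun t => Real.exp (2 * t) * (1 + Real.exp (2 * t)) ^ N *
        Real.exp (2 * u (Real.exp t))) where
  deriv_U t := by
    have h1 := (h.hasDerivAt (Real.exp_pos t)).comp t (Real.hasDerivAt_exp t)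
    refine h1.congr_deriv ?_
    rw [IsSol.derivWithin_eq (Real.exp_pos t)]
    ring
  deriv_m t := by
    have h1 := (h.hasDerivAt_mass (Real.exp_pos t)).comp t (Real.hasDerivAt_exp t)
    refine h1.congr_deriv ?_
    rw [two_mul t, Real.exp_add]
    ring_nf
  g_eq t := rfl
  U_bot := by
    have h1 : Tendsto u (𝓝[>] 0) (𝓝 (u 0)) :=
      (h.1.continuousOn 0 self_mem_Ici).mono_left (nhdsWithin_mono _ Ioi_subset_Ici_self)
    exact h1.comp Real.tendsto_exp_atBot_nhdsGT
  m_bot := by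
    have h1 : Tendsto (derivWithin u (Ici 0)) (𝓝[>] 0) (𝓝 (derivWithin u (Ici 0) 0)) :=
      (h.continuousOn_derivWithin 0 self_mem_Ici).mono_left
        (nhdsWithin_mono _ Ioi_subset_Ici_self)
    have h2 := (Real.tendsto_exp_atBot.mul (h1.comp Real.tendsto_exp_atBot_nhdsGT)).neg
    simpa using h2
  m_top := by
    have h1 := tendsto_limUnder_of_hasDerivAt_of_integrableOn_Ioi
      (fun r hr => h.hasDerivAt_mass hr) h.2.2.2
    have h2 : ContinuousWithinAt (fun r => -(r * derivWithin u (Ici 0) r)) (Ici 0) 0 :=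
      (continuousWithinAt_id.mul (h.continuousOn_derivWithin 0 self_mem_Ici)).neg
    have h3 := integral_Ioi_of_hasDerivAt_of_tendsto h2 (fun r hr => h.hasDerivAt_mass hr)
      h.2.2.2 h1
    rw [zero_mul, neg_zero, sub_zero] at h3
    rw [h3]
    exact h1.comp Real.tendsto_exp_atTop

lemma abs_exp_two_mul_sub_le {x y A : ℝ} (hx : x ≤ A) (hy : y ≤ A) :
    |Real.exp (2 * x) - Real.exp (2 * y)| ≤ 2 * Real.exp (2 * A) * |x - y| := by
  wlog hxy : y ≤ x generalizing x y
  · rw [abs_sub_comm, abs_sub_comm x]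
    exact this hy hx (le_of_not_ge hxy)
  rw [abs_of_nonneg (sub_nonneg.2 hxy), abs_of_nonneg (by
    have : Real.exp (2 * y) ≤ Real.exp (2 * x) := by gcongr
    linarith)]
  have h1 : Real.exp (2 * y) = Real.exp (2 * x) * Real.exp (2 * y - 2 * x) := by
    rw [← Real.exp_add]
    congr 1
    ring
  have h2 := Real.add_one_le_exp (2 * y - 2 * x)
  have h3 : Real.exp (2 * x) ≤ Real.exp (2 * A) := by gcongr
  have h4 : Real.exp (2 * x) * (2 * y - 2 * x + 1) ≤ Real.exp (2 * y) := by
    rw [h1]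
    gcongr
  have h5 : Real.exp (2 * x) * (x - y) ≤ Real.exp (2 * A) * (x - y) := by
    gcongr
  linarith

lemma IsSol.le_zero (h : IsSol N u) {r : ℝ} (hr : 0 < r) : u r ≤ u 0 := by
  have := h.isTraj.U_le (Real.log r)
  simpa only [Real.exp_log hr] using this

/-- Continuous dependence on the central value. -/
lemma IsSol.energy_le (hN : 0 < N) (hu : IsSol N u) (hv : IsSol N v) {A R : ℝ}
    (hA : u 0 ≤ A) (hB : v 0 ≤ A) (hR : 0 ≤ R) :
    (derivWithin u (Ici 0) R - derivWithin v (Ici 0) R) ^ 2 + (u R - v R) ^ 2 ≤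
      (u 0 - v 0) ^ 2 * Real.exp (((1 + R ^ 2) ^ N * (2 * Real.exp (2 * A)) + 1) * R) := by
  set L := (1 + R ^ 2) ^ N * (2 * Real.exp (2 * A)) with hL
  set p := fun r => derivWithin u (Ici 0) r - derivWithin v (Ici 0) r with hp
  set d := fun r => u r - v r with hd
  have hLpos : 0 < L := by positivity
  have hanti : AntitoneOn (fun r => (p r ^ 2 + d r ^ 2) * Real.exp (-((L + 1) * r)))
      (Icc 0 R) := by
    have hder : ∀ r ∈ Ioo 0 R, HasDerivAt (fun r => (p r ^ 2 + d r ^ 2) *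
        Real.exp (-((L + 1) * r)))
        ((2 * p r * (-(p r / r) - (1 + r ^ 2) ^ N * (Real.exp (2 * u r) - Real.exp (2 * v r)))
          + 2 * d r * p r - (L + 1) * (p r ^ 2 + d r ^ 2)) * Real.exp (-((L + 1) * r))) r := by
      intro r hr
      have hpd : HasDerivAt p (-(p r / r) -
          (1 + r ^ 2) ^ N * (Real.exp (2 * u r) - Real.exp (2 * v r))) r := by
        have h1 := (hu.hasDerivAt_deriv hr.1).sub (hv.hasDerivAt_deriv hr.1)
        refine (h1.congr_of_eventuallyEq ?_).congr_deriv ?_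
        · filter_upwards [Ioi_mem_nhds hr.1] with s hs
          simp only [hp, Pi.sub_apply, IsSol.derivWithin_eq (show 0 < s from hs)]
        · simp only [hp, IsSol.derivWithin_eq hr.1]
          ring
      have hdd : HasDerivAt d (p r) r := by
        simp only [hp, IsSol.derivWithin_eq hr.1]
        exact (hu.hasDerivAt hr.1).sub (hv.hasDerivAt hr.1)
      have he : HasDerivAt (fun r => Real.exp (-((L + 1) * r)))
          (Real.exp (-((L + 1) * r)) * -(L + 1)) r := by
        simpa using ((hasDerivAt_id r).const_mul (L + 1)).neg.exp
      refine (((hpd.pow 2).add (hdd.pow 2)).mul he).congr_deriv ?_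
      simp only [Pi.add_apply, Pi.pow_apply]
      push_cast
      ring
    refine antitoneOn_of_deriv_nonpos (convex_Icc 0 R) ?_ ?_ ?_
    · have hcu := hu.continuousOn_derivWithin.mono (Icc_subset_Ici_self : Icc 0 R ⊆ Ici 0)
      have hcv := hv.continuousOn_derivWithin.mono (Icc_subset_Ici_self : Icc 0 R ⊆ Ici 0)
      have hu' := hu.1.continuousOn.mono (Icc_subset_Ici_self : Icc 0 R ⊆ Ici 0)
      have hv' := hv.1.continuousOn.mono (Icc_subset_Ici_self : Icc 0 R ⊆ Ici 0)
      exact (((hcu.sub hcv).pow 2).add ((hu'.sub hv').pow 2)).mul (by fun_prop)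
    · rw [interior_Icc]
      exact fun r hr => (hder r hr).differentiableAt.differentiableWithinAt
    · rw [interior_Icc]
      intro r hr
      rw [(hder r hr).deriv]
      refine mul_nonpos_of_nonpos_of_nonneg ?_ (Real.exp_pos _).le
      have h1 := abs_exp_two_mul_sub_le ((hu.le_zero hr.1).trans hA) ((hv.le_zero hr.1).trans hB)
      have h2 : (1 + r ^ 2) ^ N ≤ (1 + R ^ 2) ^ N := by
        have := hr.1
        have := hr.2
        gcongr
      have h3 : |(1 + r ^ 2) ^ N * (Real.exp (2 * u r) - Real.exp (2 * v r))| ≤ L * |d r| := by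
        rw [abs_mul, abs_of_pos (by positivity), hL, mul_assoc]
        gcongr
      set F := (1 + r ^ 2) ^ N * (Real.exp (2 * u r) - Real.exp (2 * v r))
      have h4 : 0 ≤ p r * (p r / r) := by
        rw [← mul_div_assoc]
        exact div_nonneg (mul_self_nonneg _) hr.1.le
      have h5 : -(p r * F) ≤ |p r| * (L * |d r|) := by
        calc -(p r * F) ≤ |p r * F| := neg_le_abs _
          _ = |p r| * |F| := abs_mul _ _
          _ ≤ _ := by gcongr
      have h6 : 2 * (|p r| * (L * |d r|)) ≤ L * (p r ^ 2 + d r ^ 2) := by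
        have := mul_nonneg hLpos.le (sq_nonneg (|p r| - |d r|))
        have e1 := sq_abs (p r)
        have e2 := sq_abs (d r)
        rw [← e1, ← e2]
        linarith
      linarith [sq_nonneg (p r - d r)]
  have h1 := hanti (left_mem_Icc.2 hR) (right_mem_Icc.2 hR) hR
  have h0 : p 0 = 0 := by simp only [hp, hu.2.2.1, hv.2.2.1, sub_zero]
  simp only [h0, mul_zero, neg_zero, Real.exp_zero, mul_one] at h1
  rw [Real.exp_neg, ← div_eq_mul_inv, div_le_iff₀ (Real.exp_pos _)] at h1
  simpa [hp, hd] using h1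

lemma IsSol.eqOn_of_eq_zero (hN : 0 < N) (hu : IsSol N u) (hv : IsSol N v)
    (h0 : u 0 = v 0) : EqOn u v (Ici 0) := by
  intro R hR
  have h1 := hu.energy_le hN hv le_rfl h0.ge hR
  rw [h0, sub_self, zero_pow two_ne_zero, zero_mul] at h1
  have h2 : (u R - v R) ^ 2 = 0 := by
    nlinarith [sq_nonneg (u R - v R),
      sq_nonneg (derivWithin u (Ici 0) R - derivWithin v (Ici 0) R)]
  exact sub_eq_zero.1 ((pow_eq_zero_iff two_ne_zero).1 h2)

lemma IsSol.not_lt_of_level_eq (hN : 0 < N) (hu : IsSol N u) (hv : IsSol N v) {α₀ : ℝ}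
    (hα₀ : 2 * N < α₀)
    (hlu : ∫ r in Ioi (0:ℝ), (1 + r ^ 2) ^ N * Real.exp (2 * u r) * r = α₀)
    (hlv : ∫ r in Ioi (0:ℝ), (1 + r ^ 2) ^ N * Real.exp (2 * v r) * r = α₀) :
    ¬ u 0 < v 0 := by
  intro hlt
  have tu := hu.isTraj
  have tv := hv.isTraj
  rw [hlu] at tu
  rw [hlv] at tv
  refine tu.not_eventually_lt hN hα₀ tv ?_
  filter_upwards [tu.U_bot.eventually_lt tv.U_bot hlt] with t ht
  gcongr

lemma IsSol.zero_eq_of_level_eq (hN : 0 < N) (hu : IsSol N u) (hv : IsSol N v) {α₀ : ℝ}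
    (hα₀ : 2 * N < α₀)
    (hlu : ∫ r in Ioi (0:ℝ), (1 + r ^ 2) ^ N * Real.exp (2 * u r) * r = α₀)
    (hlv : ∫ r in Ioi (0:ℝ), (1 + r ^ 2) ^ N * Real.exp (2 * v r) * r = α₀) :
    u 0 = v 0 :=
  le_antisymm (not_lt.1 (hv.not_lt_of_level_eq hN hu hα₀ hlv hlu))
    (not_lt.1 (hu.not_lt_of_level_eq hN hv hα₀ hlu hlv))

end Solution

section Family

variable {N : ℝ} {u : ℝ → ℝ → ℝ}

lemma continuous_family (hN : 0 < N) (hu : ∀ a, IsSol N (u a) ∧ u a 0 = a) {R : ℝ}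
    (hR : 0 ≤ R) :
    Continuous (fun a => u a R) ∧ Continuous fun a => derivWithin (u a) (Ici 0) R := by
  have key : ∀ c, Tendsto (fun a => (derivWithin (u a) (Ici 0) R -
      derivWithin (u c) (Ici 0) R) ^ 2 + (u a R - u c R) ^ 2) (𝓝 c) (𝓝 0) := by
    intro c
    set K := Real.exp (((1 + R ^ 2) ^ N * (2 * Real.exp (2 * (c + 1))) + 1) * R)
    have h1 : Tendsto (fun a => (a - c) ^ 2 * K) (𝓝 c) (𝓝 0) := by
      have : Continuous fun a => (a - c) ^ 2 * K := by fun_prop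
      simpa using this.tendsto c
    refine squeeze_zero' (Eventually.of_forall fun a => by positivity) ?_ h1
    filter_upwards [Iio_mem_nhds (lt_add_one c)] with a ha
    have h2 := (hu a).1.energy_le hN (hu c).1 (A := c + 1)
      (by rw [(hu a).2]; exact le_of_lt ha) (by rw [(hu c).2]; linarith) hR
    rwa [(hu a).2, (hu c).2] at h2
  have lift : ∀ f : ℝ → ℝ, (∀ c, Tendsto (fun a => (f a - f c) ^ 2) (𝓝 c) (𝓝 0)) →
      Continuous f := by
    intro f hf
    refine continuous_iff_continuousAt.2 fun c => ?_
    have h1 : Tendsto (fun a => |f a - f c|) (𝓝 c) (𝓝 0) := by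
      simpa [Real.sqrt_sq_eq_abs] using (hf c).sqrt
    exact tendsto_iff_norm_sub_tendsto_zero.2 h1
  constructor
  · exact lift _ fun c => squeeze_zero (fun a => sq_nonneg _)
      (fun a => le_add_of_nonneg_left (sq_nonneg _)) (key c)
  · exact lift _ fun c => squeeze_zero (fun a => sq_nonneg _)
      (fun a => le_add_of_nonneg_right (sq_nonneg _)) (key c)

variable {α : ℝ → ℝ}

lemma exists_level_gt (hN : 0 < N) {U m g : ℝ → ℝ → ℝ}
    (h : ∀ a, IsTraj N a (α a) (U a) (m a) (g a)) {α₀ : ℝ} (hα₀ : α₀ < 2 * N + 2) :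
    ∃ a, α₀ < α a := by
  set ε := 2 * N + 2 - α₀ with hε
  have hεpos : 0 < ε := by linarith
  have h1 : Tendsto (fun T => N * (2 * N + 2) * (1 - rho T)) atTop (𝓝 0) := by
    simpa using (tendsto_rho_atTop.const_sub 1).const_mul (N * (2 * N + 2))
  obtain ⟨T, hT⟩ := (h1.eventually (gt_mem_nhds (half_pos hεpos))).exists
  have h2 : Tendsto (fun a => N * (Real.exp (2 * T) * (1 + Real.exp (2 * T)) ^ N *
      Real.exp (2 * a))) atBot (𝓝 0) := by
    simpa using (tendsto_exp_two_mul_atBot.const_mul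
      (Real.exp (2 * T) * (1 + Real.exp (2 * T)) ^ N)).const_mul N
  obtain ⟨a, ha⟩ := (h2.eventually (gt_mem_nhds (half_pos hεpos))).exists
  refine ⟨a, ?_⟩
  have := (h a).level_gap_le hN T
  linarith

lemma exists_level_le (hN : 1 < N) {U m g : ℝ → ℝ → ℝ}
    (h : ∀ a, IsTraj N a (α a) (U a) (m a) (g a)) {α₀ : ℝ} (hα₀ : 2 * N < α₀) :
    ∃ a, α a ≤ α₀ := by
  have hN0 : 0 < N := by linarith
  set ε := (α₀ - 2) * (α₀ - 2 * N) with hε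
  have hεpos : 0 < ε := mul_pos (by linarith) (by linarith)
  have h1 : Tendsto (fun T => 2 * N * (2 * N + 2) * rho T) atBot (𝓝 0) := by
    simpa using tendsto_rho_atBot.const_mul (2 * N * (2 * N + 2))
  obtain ⟨T, hT⟩ := (h1.eventually (gt_mem_nhds (half_pos hεpos))).exists
  have h2 : Tendsto (fun a => 4 * N * ((1 + (4 * N + 4) * Real.exp (-(2 * T))) *
      Real.exp (-a))) atTop (𝓝 0) := by
    simpa using (Real.tendsto_exp_neg_atTop_nhds_zero.const_mul
      (1 + (4 * N + 4) * Real.exp (-(2 * T)))).const_mul (4 * N)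
  obtain ⟨a, ha⟩ := (h2.eventually (gt_mem_nhds (half_pos hεpos))).exists
  refine ⟨a, ?_⟩
  have h3 := (h a).level_prod_le hN0 T
  by_contra! hlt
  have : ε ≤ (α a - 2) * (α a - 2 * N) := by
    rw [hε]
    apply mul_le_mul <;> linarith
  linarith

lemma exists_level_eq (hN : 1 < N) {U m g : ℝ → ℝ → ℝ}
    (h : ∀ a, IsTraj N a (α a) (U a) (m a) (g a)) (hm : ∀ t, Continuous fun a => m a t)
    (hg : ∀ t, Continuous fun a => g a t) {α₀ : ℝ} (hα₀ : α₀ ∈ Ioo (2 * N) (2 * N + 2)) :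
    ∃ a, α a = α₀ := by
  have hN0 : 0 < N := by linarith
  obtain ⟨b, hb⟩ := exists_level_gt hN0 h hα₀.2
  obtain ⟨b', hb'⟩ := exists_level_le hN h hα₀.1
  obtain ⟨c, hc⟩ : (frontier {a | α₀ < α a}).Nonempty :=
    nonempty_frontier_iff.2 ⟨⟨b, hb⟩, fun huniv => by
      have : b' ∈ {a | α₀ < α a} := huniv ▸ mem_univ b'
      exact hb'.not_gt this⟩
  rw [frontier_eq_closure_inter_closure] at hc
  have hle : α c ≤ α₀ := by
    refine le_of_tendsto' (h c).m_top fun t => ?_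
    have hcl : IsClosed {a | m a t ≤ α₀} := isClosed_le (hm t) continuous_const
    refine closure_minimal (fun a ha => ?_) hcl hc.2
    exact ((h a).m_lt t).le.trans (not_lt.1 ha)
  refine ⟨c, le_antisymm hle ?_⟩
  have hout : ∀ t, (α₀ - m c t) * (α₀ + m c t - 2 * N - 2) ≤ g c t := by
    intro t
    have hcl : IsClosed {a | (α₀ - m a t) * (α₀ + m a t - 2 * N - 2) ≤ g a t} := by
      have := hm t
      have := hg t
      exact isClosed_le (by fun_prop) (by fun_prop)
    refine closure_minimal (fun a ha => ?_) hcl hc.1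
    have h1 := (h a).outer_lt hN0 t
    have h2 : α₀ < α a := ha
    have h3 : 0 ≤ (α a - α₀) * (α a + α₀ - 2 * N - 2) :=
      mul_nonneg (by linarith) (by linarith [hα₀.1])
    simp only [mem_ofPred_eq]
    linarith
  have hlim : (α₀ - α c) * (α₀ + α c - 2 * N - 2) ≤ 0 :=
    le_of_tendsto_of_tendsto' (((h c).m_top.const_sub α₀).mul
      ((((h c).m_top.const_add α₀).sub_const (2 * N)).sub_const 2)) ((h c).g_top hN0) hout
  have h2 := (h c).two_lt_level hN0
  by_contra! hlt
  have := mul_pos (sub_pos.2 hlt) (show 0 < α₀ + α c - 2 * N - 2 by linarith [hα₀.1])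
  linarith

end Family

/-- For `N > 1` and every `α₀ ∈ (2N, 2(N+1))`, there is a unique `a ∈ ℝ` with
`α(a) = α₀`; equivalently, there is exactly one radial solution at level `α₀`. -/
theorem uniqueness_high_levels (N : ℝ) (hN : 1 < N)
    (u : ℝ → ℝ → ℝ) (hu : ∀ a : ℝ, IsSol N (u a) ∧ u a 0 = a)
    (α : ℝ → ℝ)
    (hα : ∀ a : ℝ, α a = ∫ r in Ioi (0:ℝ), (1 + r ^ 2) ^ N * Real.exp (2 * u a r) * r) :
    ∀ α₀ ∈ Ioo (2 * N) (2 * (N + 1)),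
      (∃! a : ℝ, α a = α₀) ∧
      (∃ v : ℝ → ℝ, IsSolAtLevel N α₀ v) ∧
      (∀ v w : ℝ → ℝ, IsSolAtLevel N α₀ v → IsSolAtLevel N α₀ w → EqOn v w (Ici 0)) := by
  intro α₀ hα₀
  have hN0 : 0 < N := by linarith
  have hα₀' : α₀ ∈ Ioo (2 * N) (2 * N + 2) := ⟨hα₀.1, by linarith [hα₀.2]⟩
  have ht := fun a => (hu a).1.isTraj
  simp only [← hα, (hu _).2] at ht
  obtain ⟨a, ha⟩ := exists_level_eq hN ht
    (fun t => ((continuous_family hN0 hu (Real.exp_pos t).le).2.const_mul _).neg)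
    (fun t => (((continuous_family hN0 hu (Real.exp_pos t).le).1.const_mul 2).rexp.const_mul _))
    hα₀'
  refine ⟨⟨a, ha, fun b hb => ?_⟩, ⟨u a, ?_⟩, fun v w hv hw => ?_⟩
  · have := (hu b).1.zero_eq_of_level_eq hN0 (hu a).1 hα₀.1 ((hα b).symm.trans hb)
      ((hα a).symm.trans ha)
    rwa [(hu a).2, (hu b).2] at this
  · obtain ⟨h1, h2, h3, h4⟩ := (hu a).1
    exact ⟨h1, h2, h3, h4, (hα a).symm.trans ha⟩
  · obtain ⟨v1, v2, v3, v4, v5⟩ := hv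
    obtain ⟨w1, w2, w3, w4, w5⟩ := hw
    have sv : IsSol N v := ⟨v1, v2, v3, v4⟩
    have sw : IsSol N w := ⟨w1, w2, w3, w4⟩
    exact sv.eqOn_of_eq_zero hN0 sw (sv.zero_eq_of_level_eq hN0 sw hα₀.1 v5 w5)
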